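/- There exists a constant K_n depending only on the dimension n such that the following holds: if μ is a Radon measure on ℝⁿ satisfying μ(B_R(x)) ≤ M R^{n−1} for all x ∈ ℝⁿ and all R > 0, then for every φ ∈ C¹_c(ℝⁿ): |∫_{ℝⁿ} φ dμ| ≤ K_n M ∫_{ℝⁿ} |∇φ| dx. -/

import Mathlib

open MeasureTheory Real Set Filter

noncomputable section

abbrev Euc (n : ℕ) := EuclideanSpace ℝ (Fin n)

lemma z_ftc {n : ℕ} (v : Euc n → ℝ) (hv : ContDiff ℝ 1 v) (x z : Euc n) :
    ‖v (x + z) - v x‖ₑ ≤ ∫⁻ s in Ioc (0:ℝ) 1, ‖fderiv ℝ v (x + s • z)‖ₑ * ‖z‖ₑ := by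
  have hc : Continuous fun s : ℝ => fderiv ℝ v (x + s • z) z := by
    have := hv.continuous_fderiv (by norm_num)
    exact (this.comp (by fun_prop)).clm_apply continuous_const
  have h1 : ∀ s ∈ uIcc (0:ℝ) 1, HasDerivAt (fun s : ℝ => v (x + s • z))
      (fderiv ℝ v (x + s • z) z) s := by
    intro s _
    have h2 : HasDerivAt (fun s : ℝ => x + s • z) z s := by
      simpa using ((hasDerivAt_id s).smul_const z).const_add x
    have h3 := (hv.differentiable (by norm_num) (x + s • z)).hasFDerivAt
    exact h3.comp_hasDerivAt s h2
  have h4 := intervalIntegral.integral_eq_sub_of_hasDerivAt h1 (hc.intervalIntegrable 0 1)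
  simp only [one_smul, zero_smul, add_zero] at h4
  rw [← h4, intervalIntegral.integral_of_le zero_le_one]
  refine (enorm_integral_le_lintegral_enorm _).trans (lintegral_mono fun s => ?_)
  exact ContinuousLinearMap.le_opENorm _ _

lemma z_pair {n : ℕ} (v : Euc n → ℝ) (hv : ContDiff ℝ 1 v) (c : Euc n) (r : ℝ)
    (S T : Set (Euc n)) (hS : MeasurableSet S) (hT : MeasurableSet T)
    (hSB : S ⊆ Metric.closedBall c r) (hTB : T ⊆ Metric.closedBall c r)
    (hS1 : ∀ x ∈ S, v x = 1) (hT0 : ∀ x ∈ T, v x = 0) :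
    volume S * volume T ≤ ENNReal.ofReal (2 * r) * volume (Metric.closedBall (0 : Euc n) (2 * r))
      * ∫⁻ x in Metric.closedBall c r, ‖fderiv ℝ v x‖ₑ := by
  set B := Metric.closedBall c r with hB
  have hBm : MeasurableSet B := Metric.isClosed_closedBall.measurableSet
  set G : Euc n → ENNReal := B.indicator (fun x => ‖fderiv ℝ v x‖ₑ) with hG
  have hGm : Measurable G :=
    ((hv.continuous_fderiv (by norm_num)).enorm.measurable).indicator hBm
  have hIG : ∫⁻ x in B, ‖fderiv ℝ v x‖ₑ = ∫⁻ x, G x := (lintegral_indicator hBm _).symm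
  set a : Euc n → ENNReal := S.indicator 1 with ha
  set b : Euc n → ENNReal := T.indicator 1 with hb
  have ham : Measurable a := measurable_one.indicator hS
  have hbm : Measurable b := measurable_one.indicator hT
  have e1 : volume S * volume T = ∫⁻ z, ∫⁻ x, a x * b (x + z) := by
    rw [lintegral_lintegral_swap]
    · have : ∀ x, ∫⁻ z, a x * b (x + z) = a x * volume T := by
        intro x
        rw [lintegral_const_mul _ (by fun_prop), lintegral_add_left_eq_self b x,
          lintegral_indicator_one hT]
      simp_rw [this]
      rw [lintegral_mul_const _ ham, lintegral_indicator_one hS]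
    · apply Measurable.aemeasurable
      simp only [Function.uncurry_def]
      fun_prop
  set D := Metric.closedBall (0 : Euc n) (2 * r) with hD
  have hDm : MeasurableSet D := Metric.isClosed_closedBall.measurableSet
  have key : ∀ z, ∫⁻ x, a x * b (x + z) ≤
      D.indicator (fun _ => ENNReal.ofReal (2 * r) * ∫⁻ x, G x) z := by
    intro z
    have pt : ∀ x, a x * b (x + z) ≤
        D.indicator (fun _ => ENNReal.ofReal (2 * r) * ∫⁻ s in Ioc (0:ℝ) 1, G (x + s • z)) z := by
      intro x
      by_cases hx : x ∈ S
      swap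
      · simp [ha, hx]
      by_cases hy : x + z ∈ T
      swap
      · simp [hb, hy]
      have hxB := hSB hx
      have hyB := hTB hy
      have hz : ‖z‖ ≤ 2 * r := by
        have h1 : dist (x + z) x ≤ dist (x + z) c + dist x c := dist_triangle_right _ _ _
        rw [hB, Metric.mem_closedBall] at hxB hyB
        rw [dist_eq_norm, add_sub_cancel_left] at h1
        linarith
      have hzD : z ∈ D := by simpa [hD] using hz
      rw [indicator_of_mem hzD]
      have h := z_ftc v hv x z
      rw [hS1 x hx, hT0 _ hy] at h
      have h1 : a x * b (x + z) = ‖(0:ℝ) - 1‖ₑ := by simp [ha, hb, hx, hy]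
      rw [h1]
      refine h.trans ?_
      rw [← lintegral_const_mul _ (by fun_prop)]
      refine setLIntegral_mono' measurableSet_Ioc fun s hs => ?_
      have hmem : x + s • z ∈ B := by
        have := (convex_closedBall c r).add_smul_mem hxB hyB ⟨hs.1.le, hs.2⟩
        exact this
      rw [hG, indicator_of_mem hmem, mul_comm]
      gcongr
      rw [← ofReal_norm]
      exact ENNReal.ofReal_le_ofReal hz
    refine (lintegral_mono pt).trans ?_
    by_cases hzD : z ∈ D
    swap
    · simp [hzD]
    simp only [indicator_of_mem hzD]
    rw [lintegral_const_mul _ (by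
      apply Measurable.lintegral_prod_right' (f := fun p : Euc n × ℝ => G (p.1 + p.2 • z))
      fun_prop)]
    gcongr ENNReal.ofReal (2 * r) * ?_
    rw [lintegral_lintegral_swap]
    · have : ∀ s : ℝ, ∫⁻ x, G (x + s • z) = ∫⁻ x, G x := fun s =>
        lintegral_add_right_eq_self G (s • z)
      simp [this]
    · apply Measurable.aemeasurable
      simp only [Function.uncurry_def]
      fun_prop
  rw [e1, hIG]
  refine (lintegral_mono key).trans ?_
  rw [lintegral_indicator hDm, setLIntegral_const]
  apply le_of_eq; ring

lemma z_vol {n : ℕ} (x : Euc n) {r : ℝ} (hr : 0 ≤ r) :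
    volume (Metric.closedBall x r) = ENNReal.ofReal (r ^ n) * volume (Metric.ball (0 : Euc n) 1) := by
  have := Measure.addHaar_closedBall (volume : Measure (Euc n)) x hr
  simpa using this

lemma z_radius {n : ℕ} (hn : 1 ≤ n) (A : Set (Euc n)) (hAf : volume A ≠ ⊤)
    (ρ : ℝ) (hρ : 0 < ρ) : ∃ R : ℝ, ∀ x, Metric.closedBall x ρ ⊆ A → ∃ r, ρ ≤ r ∧ r ≤ R ∧
      2 * volume (A ∩ Metric.closedBall x r) ≤ volume (Metric.closedBall x r) ∧
      volume (Metric.closedBall x r) ≤ 2 ^ (n + 1) * volume (A ∩ Metric.closedBall x r) := by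
  set ω := volume (Metric.ball (0 : Euc n) 1) with hω
  have hω0 : 0 < ω := Metric.measure_ball_pos _ _ one_pos
  have hωt : ω ≠ ⊤ := measure_ball_lt_top.ne
  have hpos : 0 < ω.toReal := ENNReal.toReal_pos hω0.ne' hωt
  obtain ⟨K, hK⟩ : ∃ K : ℕ, 2 * volume A ≤ ENNReal.ofReal ((2 ^ K * ρ) ^ n) * ω := by
    have h1 : Tendsto (fun K : ℕ => ((2:ℝ) ^ K * ρ) ^ n * ω.toReal) atTop atTop := by
      apply Tendsto.atTop_mul_const hpos
      apply (tendsto_pow_atTop (by omega)).comp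
      exact (tendsto_pow_atTop_atTop_of_one_lt one_lt_two).atTop_mul_const hρ
    obtain ⟨K, hK⟩ := (h1.eventually_ge_atTop (2 * (volume A).toReal)).exists
    refine ⟨K, ?_⟩
    have := ENNReal.ofReal_le_ofReal hK
    rwa [ENNReal.ofReal_mul (by positivity), ENNReal.ofReal_mul (by positivity),
      ENNReal.ofReal_toReal hωt, ENNReal.ofReal_toReal hAf, ENNReal.ofReal_ofNat] at this
  refine ⟨2 ^ K * ρ, fun x hx => ?_⟩
  classical
  let P : ℕ → Prop := fun k => 2 * volume (A ∩ Metric.closedBall x (2 ^ k * ρ)) ≤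
    volume (Metric.closedBall x (2 ^ k * ρ))
  have hPK : P K := by
    refine le_trans ?_ (hK.trans (z_vol x (by positivity)).ge)
    gcongr
    exact inter_subset_left
  have hex : ∃ k, P k := ⟨K, hPK⟩
  have hP0 : ¬ P 0 := by
    simp only [P, pow_zero, one_mul, inter_eq_right.2 hx, not_le]
    have h1 : 0 < volume (Metric.closedBall x ρ) := Metric.measure_closedBall_pos _ _ hρ
    have h2 : volume (Metric.closedBall x ρ) ≠ ⊤ := measure_closedBall_lt_top.ne
    rw [two_mul]
    exact ENNReal.lt_add_right h2 h1.ne'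
  set k := Nat.find hex with hk
  have hPk : P k := Nat.find_spec hex
  have hkK : k ≤ K := Nat.find_min' hex hPK
  have hk0 : k ≠ 0 := fun h => hP0 (h ▸ hPk)
  obtain ⟨j, hj⟩ := Nat.exists_eq_succ_of_ne_zero hk0
  have hPj : ¬ P j := Nat.find_min hex (by omega)
  refine ⟨2 ^ k * ρ, ?_, ?_, hPk, ?_⟩
  · have : (1:ℝ) ≤ 2 ^ k := one_le_pow₀ one_le_two
    nlinarith
  · gcongr
    exact one_le_two
  · simp only [P, not_le] at hPj
    have e : volume (Metric.closedBall x (2 ^ k * ρ)) =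
        2 ^ n * volume (Metric.closedBall x (2 ^ j * ρ)) := by
      rw [z_vol x (by positivity), z_vol x (by positivity), hj, ← mul_assoc]
      congr 1
      rw [show (2:ℝ) ^ (j.succ) * ρ = 2 * (2 ^ j * ρ) by rw [pow_succ]; ring, mul_pow,
        ENNReal.ofReal_mul (by positivity), ENNReal.ofReal_pow (by positivity),
        ENNReal.ofReal_ofNat]
    rw [e, pow_succ, mul_assoc]
    gcongr
    refine hPj.le.trans ?_
    gcongr 2 * volume (A ∩ Metric.closedBall x ?_)
    rw [hj]
    gcongr
    · exact one_le_two
    · omega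

lemma z_step : ∃ D : ℝ, 0 < D ∧ ∀ s, |deriv Real.smoothTransition s| ≤
    (Icc (0:ℝ) 1).indicator (fun _ => D) s := by
  have hc : Continuous (deriv Real.smoothTransition) :=
    (Real.smoothTransition.contDiff (n := 1)).continuous_deriv (by norm_num)
  obtain ⟨D, hD⟩ := (isCompact_Icc (a := (0:ℝ)) (b := 1)).exists_bound_of_continuousOn hc.continuousOn
  refine ⟨max D 1, by positivity, fun s => ?_⟩
  by_cases hs : s ∈ Icc (0:ℝ) 1
  · rw [indicator_of_mem hs]
    exact (hD s hs).trans (le_max_left _ _)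
  · rw [indicator_of_notMem hs]
    have : deriv Real.smoothTransition s = 0 := by
      rw [mem_Icc, not_and_or, not_le, not_le] at hs
      rcases hs with hs | hs
      · have : Real.smoothTransition =ᶠ[nhds s] fun _ => 0 := by
          filter_upwards [Iio_mem_nhds hs] with y hy
          exact Real.smoothTransition.zero_of_nonpos (le_of_lt hy)
        rw [this.deriv_eq]; simp
      · have : Real.smoothTransition =ᶠ[nhds s] fun _ => 1 := by
          filter_upwards [Ioi_mem_nhds hs] with y hy
          exact Real.smoothTransition.one_of_one_le (le_of_lt hy)
        rw [this.deriv_eq]; simp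
    simp [this]

lemma z_trunc {n : ℕ} (D : ℝ) (hD : 0 < D) (hDs : ∀ s, |deriv Real.smoothTransition s| ≤
    (Icc (0:ℝ) 1).indicator (fun _ => D) s) (φ : Euc n → ℝ) (hφ : ContDiff ℝ 1 φ)
    (t N : ℝ) (hN : 0 < N) :
    ∃ v : Euc n → ℝ, ContDiff ℝ 1 v ∧ (∀ x, t ≤ φ x → v x = 1) ∧ (∀ x, φ x ≤ t - 1 / N → v x = 0) ∧
      ∀ x, ‖fderiv ℝ v x‖ₑ ≤ ENNReal.ofReal (D * N) *
        (φ ⁻¹' (Icc (t - 1 / N) t)).indicator (fun x => ‖fderiv ℝ φ x‖ₑ) x := by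
  have hNN : N * (1 / N) = 1 := by field_simp
  refine ⟨fun x => Real.smoothTransition (N * (φ x - t) + 1), ?_, ?_, ?_, ?_⟩
  · exact Real.smoothTransition.contDiff.comp (by fun_prop)
  · intro x hx
    exact Real.smoothTransition.one_of_one_le (by nlinarith)
  · intro x hx
    apply Real.smoothTransition.zero_of_nonpos
    nlinarith
  · intro x
    have h1 : HasFDerivAt (fun x => N * (φ x - t) + 1) (N • fderiv ℝ φ x) x := by
      have := (hφ.differentiable (by norm_num) x).hasFDerivAt
      exact ((this.sub_const t).const_mul N).add_const 1
    have h2 : HasDerivAt Real.smoothTransition _ (N * (φ x - t) + 1) :=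
      ((Real.smoothTransition.contDiff (n := 1)).differentiable (by norm_num) _).hasDerivAt
    have h3 := h2.comp_hasFDerivAt x h1
    have h4 : fderiv ℝ (fun x => Real.smoothTransition (N * (φ x - t) + 1)) x = _ := h3.fderiv
    rw [h4]
    have h5 := hDs (N * (φ x - t) + 1)
    by_cases hx : φ x ∈ Icc (t - 1 / N) t
    · have hx' : x ∈ φ ⁻¹' (Icc (t - 1 / N) t) := hx
      rw [indicator_of_mem hx', enorm_smul, enorm_smul, ← mul_assoc,
        ENNReal.ofReal_mul hD.le]
      gcongr
      · rw [← ofReal_norm]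
        apply ENNReal.ofReal_le_ofReal
        rw [Real.norm_eq_abs]
        exact h5.trans (indicator_le_self' (fun _ _ => hD.le) _)
      · rw [← ofReal_norm, Real.norm_of_nonneg hN.le]
    · have : N * (φ x - t) + 1 ∉ Icc (0:ℝ) 1 := by
        intro h
        apply hx
        constructor
        · have := h.1
          by_contra! h'
          nlinarith
        · have := h.2
          by_contra! h'
          nlinarith
      rw [indicator_of_notMem this] at h5
      have h6 : deriv Real.smoothTransition (N * (φ x - t) + 1) = 0 := by
        simpa using le_antisymm h5 (abs_nonneg _)
      rw [enorm_smul, h6, enorm_zero, zero_mul]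
      exact bot_le

lemma z_small {n : ℕ} (φ : Euc n → ℝ) (hφ : Continuous φ) (hs : HasCompactSupport φ)
    (t : ℝ) (ht : 0 < t) (η : ENNReal) (hη : 0 < η) :
    ∀ᶠ k : ℕ in atTop, volume (φ ⁻¹' (Ioo (t - 1 / ((k:ℝ) + 1)) t)) ≤ η := by
  have h1 : Tendsto (volume ∘ fun k : ℕ => φ ⁻¹' (Ioo (t - 1 / ((k:ℝ) + 1)) t)) atTop
      (nhds (volume (⋂ k : ℕ, φ ⁻¹' (Ioo (t - 1 / ((k:ℝ) + 1)) t)))) := by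
    apply tendsto_measure_iInter_atTop
    · intro k
      exact (hφ.measurable measurableSet_Ioo).nullMeasurableSet
    · intro k l hkl
      apply preimage_mono
      apply Ioo_subset_Ioo_left
      have := Nat.one_div_le_one_div (α := ℝ) hkl
      linarith
    · obtain ⟨k, hk⟩ := exists_nat_one_div_lt ht
      refine ⟨k, ((measure_mono ?_).trans_lt hs.isCompact.measure_lt_top).ne⟩
      intro x hx
      apply subset_tsupport
      have := hx.1
      simp only [Function.mem_support]
      intro h
      linarith
  have h2 : (⋂ k : ℕ, φ ⁻¹' (Ioo (t - 1 / ((k:ℝ) + 1)) t)) = ∅ := by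
    ext x
    simp only [mem_iInter, mem_preimage, mem_Ioo, mem_empty_iff_false, iff_false]
    intro h
    obtain ⟨k, hk⟩ := exists_nat_one_div_lt (sub_pos.2 (h 0).2)
    have := (h k).1
    linarith
  rw [h2, measure_empty] at h1
  exact h1.eventually_le_const hη

lemma z_arith {n : ℕ} (hn : 1 ≤ n) (r : ℝ) (hr : 0 < r) (x : Euc n) (s T I : ENNReal)
    (hs : volume (Metric.closedBall x r) ≤ 2 ^ (n + 1) * s)
    (hT : volume (Metric.closedBall x r) ≤ 4 * T)
    (h : s * T ≤ ENNReal.ofReal (2 * r) * volume (Metric.closedBall (0 : Euc n) (2 * r)) * I) :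
    ENNReal.ofReal (r ^ (n - 1)) ≤
      ENNReal.ofReal (2 ^ (2 * n + 4) / (volume (Metric.ball (0 : Euc n) 1)).toReal) * I := by
  rw [z_vol _ (by positivity)] at hs hT h
  set ω := volume (Metric.ball (0 : Euc n) 1) with hω
  have hω0 : 0 < ω := Metric.measure_ball_pos _ _ one_pos
  have hωt : ω ≠ ⊤ := measure_ball_lt_top.ne
  have hpos : 0 < ω.toReal := ENNReal.toReal_pos hω0.ne' hωt
  by_cases hI : I = ⊤
  · rw [hI, ENNReal.mul_top]
    · exact le_top
    · simp only [ne_eq, ENNReal.ofReal_eq_zero, not_le]; positivity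
  have h1 : (ENNReal.ofReal (r ^ n) * ω) * (ENNReal.ofReal (r ^ n) * ω) ≤
      2 ^ (n + 1) * 4 * (ENNReal.ofReal (2 * r) * (ENNReal.ofReal ((2 * r) ^ n) * ω) * I) := by
    calc _ ≤ (2 ^ (n + 1) * s) * (4 * T) := mul_le_mul' hs hT
      _ = 2 ^ (n + 1) * 4 * (s * T) := by ring
      _ ≤ _ := by gcongr
  rw [← ENNReal.ofReal_toReal hI, ← ENNReal.ofReal_toReal hωt] at h1
  rw [← ENNReal.ofReal_toReal hI, ← ENNReal.ofReal_mul (by positivity)]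
  apply ENNReal.ofReal_le_ofReal
  set w := ω.toReal
  set i := I.toReal
  have hi : 0 ≤ i := ENNReal.toReal_nonneg
  rw [show (2:ENNReal) ^ (n + 1) * 4 = ENNReal.ofReal (2 ^ (n + 1) * 4) by
    rw [ENNReal.ofReal_mul (by positivity), ENNReal.ofReal_pow (by positivity)]; simp] at h1
  rw [← ENNReal.ofReal_mul (by positivity), ← ENNReal.ofReal_mul (by positivity),
    ← ENNReal.ofReal_mul (by positivity), ← ENNReal.ofReal_mul (by positivity),
    ← ENNReal.ofReal_mul (by positivity), ← ENNReal.ofReal_mul (by positivity),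
    ENNReal.ofReal_le_ofReal_iff (by positivity)] at h1
  obtain ⟨m, rfl⟩ : ∃ m, n = m + 1 := ⟨n - 1, by omega⟩
  simp only [Nat.add_sub_cancel]
  rw [div_mul_eq_mul_div, le_div_iff₀ hpos]
  have hq : 0 < r ^ (m + 1) * w * r := by positivity
  refine le_of_mul_le_mul_left ?_ hq
  calc _ = r ^ (m+1) * w * (r ^ (m + 1) * w) := by ring
    _ ≤ _ := h1
    _ = _ := by rw [mul_pow]; ring

lemma z_key {n : ℕ} (hn : 1 ≤ n) : ∃ C : ℝ, 0 < C ∧ ∀ (μ : Measure (Euc n)) (M : ℝ), 0 ≤ M →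
      (∀ (x : Euc n) (R : ℝ), 0 < R →
        μ (Metric.ball x R) ≤ ENNReal.ofReal (M * R ^ ((n : ℝ) - 1))) →
      ∀ φ : Euc n → ℝ, ContDiff ℝ 1 φ → HasCompactSupport φ → ∀ t : ℝ, 0 < t → ∀ δ : ℝ, 0 < δ →
      ∀ᶠ k : ℕ in atTop, μ {x | t + δ ≤ φ x} ≤ ENNReal.ofReal (C * M) *
        (ENNReal.ofReal ((k:ℝ) + 1) * ∫⁻ x, (φ ⁻¹' (Icc (t - 1 / ((k:ℝ) + 1)) t)).indicator
          (fun x => ‖fderiv ℝ φ x‖ₑ) x) := by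
  obtain ⟨D, hD, hDs⟩ := z_step
  set c : ℝ := 2 ^ (2 * n + 4) / (volume (Metric.ball (0 : Euc n) 1)).toReal with hc
  have hωpos : 0 < (volume (Metric.ball (0 : Euc n) 1)).toReal :=
    ENNReal.toReal_pos (Metric.measure_ball_pos _ _ one_pos).ne' measure_ball_lt_top.ne
  have hcpos : 0 < c := by positivity
  refine ⟨6 ^ (n - 1) * c * D, by positivity, ?_⟩
  intro μ M hM hμ φ hφ hsupp t ht δ hδ
  have hφc := hφ.continuous
  obtain ⟨ρ', hρ', hu⟩ := Metric.uniformContinuous_iff.1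
    (hsupp.uniformContinuous_of_continuous hφc) δ hδ
  set ρ := ρ' / 2 with hρd
  have hρ : 0 < ρ := by positivity
  set A : Set (Euc n) := φ ⁻¹' (Ici t) with hA
  have hAm : MeasurableSet A := hφc.measurable measurableSet_Ici
  have hAf : volume A ≠ ⊤ := by
    refine ((measure_mono ?_).trans_lt hsupp.isCompact.measure_lt_top).ne
    intro x hx
    apply subset_tsupport
    have : t ≤ φ x := hx
    simp only [Function.mem_support]
    intro h
    linarith
  obtain ⟨R, hR⟩ := z_radius hn A hAf ρ hρ
  have hE : ∀ x ∈ {x | t + δ ≤ φ x}, Metric.closedBall x ρ ⊆ A := by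
    intro x hx y hy
    have h1 : dist y x < ρ' := by
      have := Metric.mem_closedBall.1 hy
      linarith
    have h2 := hu h1
    rw [Real.dist_eq, abs_lt] at h2
    have h3 : t + δ ≤ φ x := hx
    show t ≤ φ y
    linarith [h2.1]
  have hch : ∀ x, ∃ r, x ∈ {x | t + δ ≤ φ x} → ρ ≤ r ∧ r ≤ R ∧
      2 * volume (A ∩ Metric.closedBall x r) ≤ volume (Metric.closedBall x r) ∧
      volume (Metric.closedBall x r) ≤ 2 ^ (n + 1) * volume (A ∩ Metric.closedBall x r) := by
    intro x
    by_cases hx : x ∈ {x | t + δ ≤ φ x}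
    · obtain ⟨r, hr⟩ := hR x (hE x hx)
      exact ⟨r, fun _ => hr⟩
    · exact ⟨0, fun h => absurd h hx⟩
  choose r hr using hch
  obtain ⟨u, huE, hud, huc⟩ := Vitali.exists_disjoint_subfamily_covering_enlargement_closedBall
    {x | t + δ ≤ φ x} (fun x => x) r R (fun a ha => (hr a ha).2.1) 5 (by norm_num)
  have hrpos : ∀ x ∈ {x | t + δ ≤ φ x}, 0 < r x := fun x hx => hρ.trans_le (hr x hx).1
  have hucount : u.Countable := by
    apply hud.countable_of_nonempty_interior
    intro x hx
    refine ⟨x, Metric.ball_subset_interior_closedBall (Metric.mem_ball_self (hrpos x (huE hx)))⟩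
  set η := volume (Metric.closedBall (0 : Euc n) ρ) / 4 with hη
  have hηpos : 0 < η :=
    ENNReal.div_pos (Metric.measure_closedBall_pos _ _ hρ).ne' (by norm_num)
  filter_upwards [z_small φ hφc hsupp t ht η hηpos] with k hk
  have hk1 : (0:ℝ) < (k:ℝ) + 1 := by positivity
  obtain ⟨v, hv, hv1, hv0, hvd⟩ := z_trunc D hD hDs φ hφ t ((k:ℝ) + 1) hk1
  have hball : ∀ x ∈ {x | t + δ ≤ φ x}, ENNReal.ofReal (r x ^ (n - 1)) ≤
      ENNReal.ofReal c * ∫⁻ y in Metric.closedBall x (r x), ‖fderiv ℝ v y‖ₑ := by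
    intro x hx
    obtain ⟨h1, h2, h3, h4⟩ := hr x hx
    set B := Metric.closedBall x (r x) with hB
    have hBm : MeasurableSet B := Metric.isClosed_closedBall.measurableSet
    have hTm : MeasurableSet (φ ⁻¹' (Iic (t - 1 / ((k:ℝ) + 1))) ∩ B) :=
      (hφc.measurable measurableSet_Iic).inter hBm
    refine z_arith hn (r x) (hrpos x hx) x _
      (volume (φ ⁻¹' (Iic (t - 1 / ((k:ℝ) + 1))) ∩ B)) _ h4 ?_
      (z_pair v hv x (r x) (A ∩ B) _ (hAm.inter hBm) hTm inter_subset_right inter_subset_right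
        (fun y hy => hv1 y hy.1) (fun y hy => hv0 y hy.1))
    have hcov : B ⊆ (A ∩ B) ∪ ((φ ⁻¹' (Iic (t - 1 / ((k:ℝ) + 1))) ∩ B) ∪
        φ ⁻¹' (Ioo (t - 1 / ((k:ℝ) + 1)) t)) := by
      intro y hy
      by_cases ha : t ≤ φ y
      · exact Or.inl ⟨ha, hy⟩
      · by_cases hb : φ y ≤ t - 1 / ((k:ℝ) + 1)
        · exact Or.inr (Or.inl ⟨hb, hy⟩)
        · exact Or.inr (Or.inr ⟨not_le.1 hb, not_le.1 ha⟩)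
    have hm := (measure_mono (μ := volume) hcov).trans ((measure_union_le _ _).trans
      (add_le_add_right (measure_union_le _ _) _))
    have hρB : volume (Metric.closedBall (0 : Euc n) ρ) ≤ volume B := by
      rw [hB, z_vol _ hρ.le, z_vol _ (hρ.le.trans h1)]
      gcongr
    have hN : 4 * volume (φ ⁻¹' (Ioo (t - 1 / ((k:ℝ) + 1)) t)) ≤ volume B := by
      calc _ ≤ 4 * η := by gcongr
        _ = volume (Metric.closedBall (0 : Euc n) ρ) := by
          rw [hη]; exact ENNReal.mul_div_cancel (by norm_num) (by norm_num)
        _ ≤ _ := hρB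
    have hBt : volume B ≠ ⊤ := measure_closedBall_lt_top.ne
    have hTt : volume (φ ⁻¹' (Iic (t - 1 / ((k:ℝ) + 1))) ∩ B) ≠ ⊤ :=
      ((measure_mono inter_subset_right).trans_lt hBt.lt_top).ne
    have hSt : volume (A ∩ B) ≠ ⊤ :=
      ((measure_mono inter_subset_right).trans_lt hBt.lt_top).ne
    have hNt : volume (φ ⁻¹' (Ioo (t - 1 / ((k:ℝ) + 1)) t)) ≠ ⊤ := by
      intro h
      rw [h] at hN
      apply hBt
      simpa using hN
    generalize volume B = b at *
    generalize volume (A ∩ B) = s at *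
    generalize volume (φ ⁻¹' (Iic (t - 1 / ((k:ℝ) + 1))) ∩ B) = T at *
    generalize volume (φ ⁻¹' (Ioo (t - 1 / ((k:ℝ) + 1)) t)) = N at *
    lift b to NNReal using hBt
    lift s to NNReal using hSt
    lift T to NNReal using hTt
    lift N to NNReal using hNt
    norm_cast at h3 hm hN ⊢
    rw [← NNReal.coe_le_coe] at *
    push_cast at *
    linarith
  have hcover : {x | t + δ ≤ φ x} ⊆ ⋃ x ∈ u, Metric.ball x (6 * r x) := by
    intro x hx
    obtain ⟨b, hb, hbx⟩ := huc x hx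
    refine mem_iUnion₂.2 ⟨b, hb, ?_⟩
    have h1 := hbx (Metric.mem_closedBall_self (hrpos x hx).le)
    have h2 := hrpos b (huE hb)
    rw [Metric.mem_closedBall] at h1
    rw [Metric.mem_ball]
    linarith
  have hdis : ∑' x : u, ∫⁻ y in Metric.closedBall (x : Euc n) (r x), ‖fderiv ℝ v y‖ₑ ≤
      ∫⁻ y, ‖fderiv ℝ v y‖ₑ := by
    rw [← lintegral_biUnion hucount
      (fun x _ => Metric.isClosed_closedBall.measurableSet) hud]
    exact setLIntegral_le_lintegral _ _
  have hmeasI : Measurable ((φ ⁻¹' (Icc (t - 1 / ((k:ℝ) + 1)) t)).indicator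
          (fun x => ‖fderiv ℝ φ x‖ₑ)) :=
    ((hφ.continuous_fderiv (by norm_num)).enorm.measurable).indicator
      (hφc.measurable measurableSet_Icc)
  calc μ {x | t + δ ≤ φ x} ≤ ∑' x : u, μ (Metric.ball (x : Euc n) (6 * r x)) :=
        (measure_mono hcover).trans (measure_biUnion_le μ hucount _)
    _ ≤ ∑' x : u, ENNReal.ofReal (M * 6 ^ (n - 1) * c) *
          ∫⁻ y in Metric.closedBall (x : Euc n) (r x), ‖fderiv ℝ v y‖ₑ := by
        refine ENNReal.tsum_le_tsum fun x => ?_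
        have hx := hrpos x (huE x.2)
        refine (hμ x (6 * r x) (by positivity)).trans ?_
        have e : (6 * r x) ^ ((n:ℝ) - 1) = 6 ^ (n - 1) * r x ^ (n - 1) := by
          rw [← mul_pow, ← Real.rpow_natCast, Nat.cast_sub hn, Nat.cast_one]
        rw [e, ← mul_assoc, ENNReal.ofReal_mul (by positivity),
          ENNReal.ofReal_mul (p := M * 6 ^ (n - 1)) (by positivity), mul_assoc]
        gcongr
        exact hball x (huE x.2)
    _ ≤ ENNReal.ofReal (M * 6 ^ (n - 1) * c) * ∫⁻ y, ‖fderiv ℝ v y‖ₑ := by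
        rw [ENNReal.tsum_mul_left]
        gcongr
    _ ≤ ENNReal.ofReal (M * 6 ^ (n - 1) * c) * (ENNReal.ofReal (D * ((k:ℝ) + 1)) *
        ∫⁻ x, (φ ⁻¹' (Icc (t - 1 / ((k:ℝ) + 1)) t)).indicator
          (fun x => ‖fderiv ℝ φ x‖ₑ) x) := by
        rw [← lintegral_const_mul _ hmeasI]
        gcongr with y
        exact hvd y
    _ = _ := by
        rw [← mul_assoc, ← mul_assoc, ← ENNReal.ofReal_mul (by positivity),
          ← ENNReal.ofReal_mul (by positivity)]
        congr 2
        ring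

lemma z_layer {n : ℕ} (hn : 1 ≤ n) : ∃ C : ℝ, 0 < C ∧ ∀ (μ : Measure (Euc n)) (M : ℝ), 0 ≤ M →
      (∀ (x : Euc n) (R : ℝ), 0 < R →
        μ (Metric.ball x R) ≤ ENNReal.ofReal (M * R ^ ((n : ℝ) - 1))) →
      ∀ φ : Euc n → ℝ, ContDiff ℝ 1 φ → HasCompactSupport φ →
      ∫⁻ x, ENNReal.ofReal (φ x) ∂μ ≤ ENNReal.ofReal (C * M) * ∫⁻ x, ‖fderiv ℝ φ x‖ₑ := by
  obtain ⟨C, hC, hkey⟩ := z_key hn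
  refine ⟨C, hC, ?_⟩
  intro μ M hM hμ φ hφ hs
  have hφc := hφ.continuous
  have hGm : Measurable (fun x => ‖fderiv ℝ φ x‖ₑ) :=
    (hφ.continuous_fderiv (by norm_num)).enorm.measurable
  have e1 : ∫⁻ x, ENNReal.ofReal (φ x) ∂μ = ∫⁻ t in Ioi (0:ℝ), μ {x | t < φ x} := by
    have h1 := lintegral_eq_lintegral_meas_lt (f := fun x => max (φ x) 0) μ
      (Eventually.of_forall fun x => le_max_right _ _)
      (hφc.max continuous_const).measurable.aemeasurable
    have h2 : ∀ x, ENNReal.ofReal (max (φ x) 0) = ENNReal.ofReal (φ x) := by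
      intro x
      rcases le_total (φ x) 0 with h | h
      · simp [h]
      · simp [h]
    simp only [h2] at h1
    rw [h1]
    refine setLIntegral_congr_fun measurableSet_Ioi fun t ht => ?_
    have : ¬ t < 0 := not_lt.2 (le_of_lt ht)
    simp [lt_max_iff, this]
  set F : ℕ → ℝ → ENNReal := fun k t => ENNReal.ofReal (C * M) *
        (ENNReal.ofReal ((k:ℝ) + 1) * ∫⁻ x, (φ ⁻¹' (Icc (t - 1 / ((k:ℝ) + 1)) t)).indicator
          (fun x => ‖fderiv ℝ φ x‖ₑ) x) with hF
  have hjm : ∀ k : ℕ, Measurable (fun p : ℝ × Euc n =>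
      (φ ⁻¹' (Icc (p.1 - 1 / ((k:ℝ) + 1)) p.1)).indicator (fun x => ‖fderiv ℝ φ x‖ₑ) p.2) := by
    intro k
    have hset : MeasurableSet {p : ℝ × Euc n | φ p.2 ∈ Icc (p.1 - 1 / ((k:ℝ) + 1)) p.1} := by
      apply IsClosed.measurableSet
      have : {p : ℝ × Euc n | φ p.2 ∈ Icc (p.1 - 1 / ((k:ℝ) + 1)) p.1} =
        {p | p.1 - 1 / ((k:ℝ) + 1) ≤ φ p.2} ∩ {p | φ p.2 ≤ p.1} := rfl
      rw [this]
      exact (isClosed_le (by fun_prop) (by fun_prop)).inter (isClosed_le (by fun_prop) (by fun_prop))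
    exact (hGm.comp measurable_snd).indicator hset
  have hFm : ∀ k, Measurable (F k) := by
    intro k
    have := (hjm k).lintegral_prod_right' (ν := volume)
    exact (this.const_mul _).const_mul _
  have hpt : ∀ t ∈ Ioi (0:ℝ), μ {x | t < φ x} ≤ liminf (fun k => F k t) atTop := by
    intro t ht
    have hU : {x | t < φ x} = ⋃ j : ℕ, {x | t + 1 / ((j:ℝ) + 1) ≤ φ x} := by
      ext x
      simp only [mem_setOf_eq, mem_iUnion]
      constructor
      · intro h
        obtain ⟨j, hj⟩ := exists_nat_one_div_lt (sub_pos.2 h)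
        exact ⟨j, by linarith⟩
      · rintro ⟨j, hj⟩
        have : (0:ℝ) < 1 / ((j:ℝ) + 1) := by positivity
        linarith
    rw [hU, Monotone.measure_iUnion]
    · refine iSup_le fun j => ?_
      exact le_liminf_of_le (by isBoundedDefault)
        (hkey μ M hM hμ φ hφ hs t ht (1 / ((j:ℝ) + 1)) (by positivity))
    · intro i j hij x hx
      have := Nat.one_div_le_one_div (α := ℝ) hij
      simp only [mem_setOf_eq] at hx ⊢
      linarith
  have hint : ∀ k, ∫⁻ t, F k t = ENNReal.ofReal (C * M) * ∫⁻ x, ‖fderiv ℝ φ x‖ₑ := by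
    intro k
    have hk1 : (0:ℝ) < (k:ℝ) + 1 := by positivity
    have hm := (hjm k).lintegral_prod_right' (ν := volume)
    simp only [hF]
    rw [lintegral_const_mul _ (hm.const_mul _), lintegral_const_mul _ hm,
      lintegral_lintegral_swap (hjm k).aemeasurable]
    have h1 : ∀ x, ∫⁻ t : ℝ, (φ ⁻¹' (Icc (t - 1 / ((k:ℝ) + 1)) t)).indicator
          (fun x => ‖fderiv ℝ φ x‖ₑ) x = ENNReal.ofReal (1 / ((k:ℝ) + 1)) * ‖fderiv ℝ φ x‖ₑ := by
      intro x
      have h2 : ∀ t : ℝ, (φ ⁻¹' (Icc (t - 1 / ((k:ℝ) + 1)) t)).indicator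
          (fun x => ‖fderiv ℝ φ x‖ₑ) x =
          (Icc (φ x) (φ x + 1 / ((k:ℝ) + 1))).indicator (fun _ => ‖fderiv ℝ φ x‖ₑ) t := by
        intro t
        have : x ∈ φ ⁻¹' (Icc (t - 1 / ((k:ℝ) + 1)) t) ↔
            t ∈ Icc (φ x) (φ x + 1 / ((k:ℝ) + 1)) := by
          simp only [mem_preimage, mem_Icc]
          constructor <;> rintro ⟨h1, h2⟩ <;> constructor <;> linarith
        by_cases h : x ∈ φ ⁻¹' (Icc (t - 1 / ((k:ℝ) + 1)) t)
        · rw [indicator_of_mem h, indicator_of_mem (this.1 h)]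
        · rw [indicator_of_notMem h, indicator_of_notMem (fun h' => h (this.2 h'))]
      simp_rw [h2]
      rw [lintegral_indicator measurableSet_Icc, setLIntegral_const, Real.volume_Icc, mul_comm]
      congr 2
      ring
    simp_rw [h1]
    rw [lintegral_const_mul _ hGm, ← mul_assoc (ENNReal.ofReal ((k:ℝ) + 1)),
      ← ENNReal.ofReal_mul hk1.le, mul_one_div_cancel hk1.ne', ENNReal.ofReal_one, one_mul]
  rw [e1]
  calc _ ≤ ∫⁻ t in Ioi (0:ℝ), liminf (fun k => F k t) atTop :=
        setLIntegral_mono' measurableSet_Ioi hpt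
    _ ≤ ∫⁻ t, liminf (fun k => F k t) atTop := setLIntegral_le_lintegral _ _
    _ ≤ liminf (fun k => ∫⁻ t, F k t) atTop := lintegral_liminf_le hFm
    _ = _ := by simp only [hint, liminf_const]

lemma z_real {n : ℕ} (φ : Euc n → ℝ) (hφ : ContDiff ℝ 1 φ) (hs : HasCompactSupport φ) :
    ∫⁻ x, ‖fderiv ℝ φ x‖ₑ = ENNReal.ofReal (∫ x, ‖gradient φ x‖) := by
  have h : ∀ x, ‖gradient φ x‖ = ‖fderiv ℝ φ x‖ := by
    intro x
    simp [gradient]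
  simp_rw [h]
  have hi : Integrable (fderiv ℝ φ) volume :=
    (hφ.continuous_fderiv (by norm_num)).integrable_of_hasCompactSupport (hs.fderiv ℝ)
  rw [ofReal_integral_norm_eq_lintegral_enorm hi]

/-- Ziemer's inequality: there is a dimensional constant `K_n` such that any
Radon measure `μ` on `ℝⁿ` with `μ(B_R(x)) ≤ M R^{n-1}` for all balls satisfies
`|∫ φ dμ| ≤ K_n M ∫ |∇φ|` for every `φ ∈ C¹_c(ℝⁿ)`. -/
theorem stmt_10 (n : ℕ) :
    ∃ K > 0, ∀ (μ : Measure (Euc n)) (M : ℝ), 0 ≤ M →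
      (∀ (x : Euc n) (R : ℝ), 0 < R →
        μ (Metric.ball x R) ≤ ENNReal.ofReal (M * R ^ ((n : ℝ) - 1))) →
      ∀ φ : Euc n → ℝ, ContDiff ℝ 1 φ → HasCompactSupport φ →
        |∫ x, φ x ∂μ| ≤ K * M * ∫ x, ‖gradient φ x‖ := by
  rcases Nat.eq_zero_or_pos n with hn | hn
  · subst hn
    refine ⟨1, one_pos, ?_⟩
    intro μ M hM hμ φ hφ hs
    have h0 : μ = 0 := by
      rw [← Measure.measure_univ_eq_zero]
      have h1 : ∀ k : ℕ, μ univ ≤ ENNReal.ofReal (M * (1 / ((k:ℝ) + 1))) := by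
        intro k
        have h2 := hμ 0 ((k:ℝ) + 1) (by positivity)
        have h3 : Metric.ball (0 : Euc 0) ((k:ℝ) + 1) = univ := by
          ext x
          have : x = 0 := Subsingleton.elim _ _
          subst this
          simp only [mem_univ, iff_true]
          exact Metric.mem_ball_self (by positivity)
        rw [h3] at h2
        convert h2 using 3
        rw [Nat.cast_zero, zero_sub, Real.rpow_neg_one, one_div]
      have h4 : Tendsto (fun k : ℕ => ENNReal.ofReal (M * (1 / ((k:ℝ) + 1)))) atTop (nhds 0) := by
        have := (tendsto_one_div_add_atTop_nhds_zero_nat (𝕜 := ℝ)).const_mul M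
        simpa using ENNReal.tendsto_ofReal this
      exact le_antisymm (ge_of_tendsto' h4 h1) bot_le
    rw [h0]
    simp only [integral_zero_measure, abs_zero]
    have : 0 ≤ ∫ x, ‖gradient φ x‖ := integral_nonneg fun x => norm_nonneg _
    positivity
  · obtain ⟨C, hC, hl⟩ := z_layer hn
    refine ⟨C, hC, ?_⟩
    intro μ M hM hμ φ hφ hs
    have hI : 0 ≤ ∫ x, ‖gradient φ x‖ := integral_nonneg fun x => norm_nonneg _
    have hCM : 0 ≤ C * M := by positivity
    by_cases hint : Integrable φ μ
    swap
    · rw [integral_undef hint, abs_zero]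
      positivity
    have h1 := hl μ M hM hμ φ hφ hs
    have h2 := hl μ M hM hμ (fun x => - φ x) hφ.neg hs.neg
    have e : ∀ x, ‖fderiv ℝ (fun x => - φ x) x‖ₑ = ‖fderiv ℝ φ x‖ₑ := by
      intro x
      rw [fderiv_fun_neg, enorm_neg]
    simp_rw [e] at h2
    rw [z_real φ hφ hs, ← ENNReal.ofReal_mul hCM] at h1 h2
    have h3 := ENNReal.toReal_le_of_le_ofReal (by positivity) h1
    have h4 := ENNReal.toReal_le_of_le_ofReal (by positivity) h2
    rw [integral_eq_lintegral_pos_part_sub_lintegral_neg_part hint, abs_le]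
    have h5 : 0 ≤ (∫⁻ x, ENNReal.ofReal (φ x) ∂μ).toReal := ENNReal.toReal_nonneg
    have h6 : 0 ≤ (∫⁻ x, ENNReal.ofReal (- φ x) ∂μ).toReal := ENNReal.toReal_nonneg
    constructor <;> linarith
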